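/- arXiv:1807.05410 — 6 statements merged into one kernel-verified Lean document; each statement's English description precedes it below -/
import Mathlib

section
/- If a measurable estimator T : E → {0,…,N} is a maximum likelihood estimator, i.e. p_{T(x)}(x) = max_{0≤j≤N} p_j(x) for μ-almost all x ∈ E, then ∑_{j=0}^{N} P_j(T(X) = j) = ∫_E max_{0≤j≤N} p_j(x) dμ(x); in particular the supremum over all estimators of the average success probability (1/(N+1)) ∑_{j=0}^{N} P_j(T = j) equals (1/(N+1)) ∫_E max_j p_j dμ. -/
open MeasureTheory

section Selection

variable {E ι : Type*} [Fintype ι]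

/-- Selecting one of finitely many functions is a sum of indicators. -/
theorem select_eq_sum_indicator (p : ι → E → ℝ) (S : E → ι) :
    (fun x => p (S x) x) = fun x => ∑ j, {x | S x = j}.indicator (p j) x := by
  classical
  funext x
  simp [Set.indicator_apply]

variable [MeasurableSpace E] {μ : Measure E} [MeasurableSpace ι]
  [MeasurableSingletonClass ι] {p : ι → E → ℝ} {S : E → ι}

/-- A measurable selection among finitely many integrable functions is integrable. -/
theorem integrable_select (hp : ∀ j, Integrable (p j) μ) (hS : Measurable S) :
    Integrable (fun x => p (S x) x) μ := by
  rw [select_eq_sum_indicator]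
  exact integrable_finsetSum _ fun j _ =>
    (hp j).indicator (hS (measurableSet_singleton j))

/-- The integrals over the level sets of `S` add up to the integral of the selection. -/
theorem sum_setIntegral_eq_integral_select (hp : ∀ j, Integrable (p j) μ) (hS : Measurable S) :
    ∑ j, ∫ x in {x | S x = j}, p j x ∂μ = ∫ x, p (S x) x ∂μ := by
  have hmeas (j : ι) : MeasurableSet {x | S x = j} := hS (measurableSet_singleton j)
  rw [select_eq_sum_indicator, integral_finsetSum _ fun j _ => (hp j).indicator (hmeas j)]
  exact Finset.sum_congr rfl fun j _ => (integral_indicator (hmeas j)).symm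

end Selection

/-- If a measurable estimator `T` is a maximum likelihood estimator, i.e.
`p_{T(x)}(x) = max_j p_j(x)` for `μ`-almost all `x`, then
`∑_j P_j(T = j) = ∫ max_j p_j dμ`; in particular the supremum over all estimators of the
average success probability equals `(1/(N+1)) ∫ max_j p_j dμ`. -/
theorem mle_achieves_bound
    {E : Type*} [MeasurableSpace E] (μ : Measure E) (N : ℕ) (hN : 1 ≤ N)
    (p : Fin (N + 1) → E → ℝ)
    (hp_meas : ∀ j, Measurable (p j))
    (hp_nonneg : ∀ j x, 0 ≤ p j x)
    (hp_int : ∀ j, Integrable (p j) μ)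
    (hp_prob : ∀ j, ∫ x, p j x ∂μ = 1)
    (T : E → Fin (N + 1)) (hT : Measurable T)
    (hMLE : ∀ᵐ x ∂μ, p (T x) x = ⨆ j, p j x) :
    (∑ j, ∫ x in {x | T x = j}, p j x ∂μ = ∫ x, ⨆ j, p j x ∂μ) ∧
      (⨆ S : {S : E → Fin (N + 1) // Measurable S},
          ((N : ℝ) + 1)⁻¹ * ∑ j, ∫ x in {x | S.1 x = j}, p j x ∂μ) =
        ((N : ℝ) + 1)⁻¹ * ∫ x, ⨆ j, p j x ∂μ := by
  have hsum : ∑ j, ∫ x in {x | T x = j}, p j x ∂μ = ∫ x, ⨆ j, p j x ∂μ :=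
    (sum_setIntegral_eq_integral_select hp_int hT).trans (integral_congr_ae hMLE)
  refine ⟨hsum, IsGreatest.csSup_eq ⟨⟨⟨T, hT⟩, by simp only [hsum]⟩, ?_⟩⟩
  rintro _ ⟨⟨S, hS⟩, rfl⟩
  dsimp only
  rw [sum_setIntegral_eq_integral_select hp_int hS]
  gcongr
  · exact integrable_select hp_int hS
  · exact (integrable_select hp_int hT).congr hMLE
  · exact fun x => le_ciSup (f := fun j => p j x) (Set.finite_range _).bddAbove (S x)
end

section
/- Let φ : [0,∞) → [0,∞) be convex, non-decreasing and non-negative, and let Q = q · μ be a probability measure whose density q is μ-a.e. strictly positive. Then φ(∫_E max_{0≤j≤N} (p_j/q) dQ) ≤ ∑_{j=0}^{N} ∫_E φ(p_j(x)/q(x)) dQ(x). Equivalently, φ(∫_E max_j p_j dμ) ≤ ∑_{j=0}^{N} ∫_E φ(p_j/q) q dμ. -/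
open MeasureTheory

/-- A convex function on a subset of `ℝ` has a supporting line at each interior point. -/
theorem ConvexOn.exists_supporting_line {s : Set ℝ} {f : ℝ → ℝ} {x : ℝ}
    (hf : ConvexOn ℝ s f) (hx : x ∈ interior s) :
    ∃ c : ℝ, ∀ y ∈ s, f x + c * (y - x) ≤ f y := by
  refine ⟨derivWithin f (Set.Ioi x) x, fun y hy => ?_⟩
  rcases lt_trichotomy y x with h | rfl | h
  · have h1 := (hf.slope_le_leftDeriv_of_mem_interior hy hx h).trans
      (hf.leftDeriv_le_rightDeriv_of_mem_interior hx)
    rw [slope_def_field, div_le_iff₀ (sub_pos.2 h)] at h1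
    linarith
  · simp
  · have h1 := hf.rightDeriv_le_slope_of_mem_interior hx hy h
    rw [slope_def_field, le_div_iff₀ (sub_pos.2 h)] at h1
    linarith

/-- Let `φ : [0,∞) → [0,∞)` be convex, non-decreasing and non-negative, and let `Q = q·μ`
be a probability measure whose density `q` is `μ`-a.e. strictly positive. Then
`φ(∫ max_j (p_j/q) dQ) ≤ ∑_j ∫ φ(p_j/q) dQ`; equivalently
`φ(∫ max_j p_j dμ) ≤ ∑_j ∫ φ(p_j/q) q dμ`. -/
theorem phi_integral_max_le_sum_integral_phi
    {E : Type*} [MeasurableSpace E] (μ : Measure E) (N : ℕ) (hN : 1 ≤ N)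
    (p : Fin (N + 1) → E → ℝ)
    (hp_meas : ∀ j, Measurable (p j))
    (hp_nonneg : ∀ j x, 0 ≤ p j x)
    (hp_int : ∀ j, Integrable (p j) μ)
    (hp_prob : ∀ j, ∫ x, p j x ∂μ = 1)
    (q : E → ℝ)
    (hq_meas : Measurable q)
    (hq_nonneg : ∀ x, 0 ≤ q x)
    (hq_int : Integrable q μ)
    (hq_prob : ∫ x, q x ∂μ = 1)
    (hq_pos : ∀ᵐ x ∂μ, 0 < q x)
    (φ : ℝ → ℝ)
    (hφ_conv : ConvexOn ℝ (Set.Ici 0) φ)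
    (hφ_mono : MonotoneOn φ (Set.Ici 0))
    (hφ_nonneg : ∀ u, 0 ≤ u → 0 ≤ φ u)
    (hφ_int : ∀ j, Integrable (fun x => φ (p j x / q x) * q x) μ) :
    φ (∫ x, (⨆ j, p j x / q x) * q x ∂μ) ≤ ∑ j, ∫ x, φ (p j x / q x) * q x ∂μ ∧
      φ (∫ x, ⨆ j, p j x ∂μ) ≤ ∑ j, ∫ x, φ (p j x / q x) * q x ∂μ := by
  have hM_meas : Measurable fun x => ⨆ j, p j x := Measurable.iSup hp_meas
  have hM_ge (j : Fin (N + 1)) (x : E) : p j x ≤ ⨆ i, p i x :=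
    le_ciSup (f := fun i => p i x) (Set.finite_range _).bddAbove j
  have hM_nonneg (x : E) : 0 ≤ ⨆ i, p i x := (hp_nonneg 0 x).trans (hM_ge 0 x)
  have hM_int : Integrable (fun x => ⨆ j, p j x) μ := by
    refine (integrable_finsetSum Finset.univ fun j _ => hp_int j).mono'
      hM_meas.aestronglyMeasurable (ae_of_all _ fun x => ?_)
    rw [Real.norm_of_nonneg (hM_nonneg x)]
    exact ciSup_le fun j => Finset.single_le_sum (f := fun i => p i x)
      (fun i _ => hp_nonneg i x) (Finset.mem_univ j)
  have h_eq : ∫ x, (⨆ j, p j x / q x) * q x ∂μ = ∫ x, ⨆ j, p j x ∂μ := by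
    refine integral_congr_ae ?_
    filter_upwards [hq_pos] with x hx
    simp only [Real.iSup_mul_of_nonneg hx.le, div_mul_cancel₀ _ hx.ne']
  rw [h_eq, and_self]
  set m := ∫ x, ⨆ j, p j x ∂μ with hm
  have hm_pos : 0 < m := by
    have h := integral_mono (hp_int 0) hM_int (hM_ge 0)
    rw [hp_prob 0] at h
    exact one_pos.trans_le h
  obtain ⟨c, hc⟩ := hφ_conv.exists_supporting_line (x := m) (by simpa using hm_pos)
  have h_int : Integrable (fun x => (φ m - c * m) * q x + c * ⨆ j, p j x) μ :=
    (hq_int.const_mul _).add (hM_int.const_mul _)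
  have h_le : ∀ᵐ x ∂μ, (φ m - c * m) * q x + c * ⨆ j, p j x ≤
      ∑ j, φ (p j x / q x) * q x := by
    filter_upwards [hq_pos] with x hx
    obtain ⟨i, hi⟩ := exists_eq_ciSup_of_finite (f := fun j => p j x)
    have h1 := mul_le_mul_of_nonneg_right (hc (p i x / q x) (div_nonneg (hp_nonneg i x) hx.le)) hx.le
    have h2 : p i x / q x * q x = p i x := div_mul_cancel₀ _ hx.ne'
    rw [← hi]
    calc (φ m - c * m) * q x + c * p i x
        = (φ m + c * (p i x / q x - m)) * q x := by linear_combination (-c) * h2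
      _ ≤ φ (p i x / q x) * q x := h1
      _ ≤ ∑ j, φ (p j x / q x) * q x :=
        Finset.single_le_sum (f := fun j => φ (p j x / q x) * q x)
          (fun j _ => mul_nonneg (hφ_nonneg _ (div_nonneg (hp_nonneg j x) hx.le)) hx.le)
          (Finset.mem_univ i)
  calc φ m = ∫ x, (φ m - c * m) * q x + c * ⨆ j, p j x ∂μ := by
        rw [integral_add (hq_int.const_mul _) (hM_int.const_mul _), integral_const_mul,
          integral_const_mul, hq_prob, ← hm]
        ring
    _ ≤ ∫ x, ∑ j, φ (p j x / q x) * q x ∂μ :=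
        integral_mono_ae h_int (integrable_finsetSum _ fun j _ => hφ_int j) h_le
    _ = ∑ j, ∫ x, φ (p j x / q x) * q x ∂μ := integral_finsetSum _ fun j _ => hφ_int j
end

section
/- Let P = p · μ and Q = q · μ be probability measures with q μ-a.e. strictly positive, and let φ = φ̄ · 1_{[1,∞)} where φ̄(u) = u log u − u + 1. Then ∫_E φ(p(x)/q(x)) q(x) dμ(x) ≤ K(P, Q), where K(P, Q) = ∫_E p log(p/q) dμ is the Kullback–Leibler divergence of P with respect to Q. -/
open MeasureTheory

/-- Let `P = p·μ` and `Q = q·μ` be probability measures with `q` `μ`-a.e. strictly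
positive, and let `φ = φ̄ · 1_{[1,∞)}` where `φ̄(u) = u log u − u + 1`. Then
`∫ φ(p/q) q dμ ≤ K(P,Q)`, where `K(P,Q) = ∫ p log(p/q) dμ` is the Kullback–Leibler
divergence (here assumed finite, i.e. the integrand is integrable). -/
theorem integral_phi_le_kl
    {E : Type*} [MeasurableSpace E] (μ : Measure E)
    (p q : E → ℝ)
    (hp_meas : Measurable p) (hq_meas : Measurable q)
    (hp_nonneg : ∀ x, 0 ≤ p x) (hq_nonneg : ∀ x, 0 ≤ q x)
    (hp_int : Integrable p μ) (hq_int : Integrable q μ)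
    (hp_prob : ∫ x, p x ∂μ = 1) (hq_prob : ∫ x, q x ∂μ = 1)
    (hq_pos : ∀ᵐ x ∂μ, 0 < q x)
    (hKL_int : Integrable (fun x => p x * Real.log (p x / q x)) μ)
    (φ : ℝ → ℝ)
    (hφ_def : ∀ u, φ u = if 1 ≤ u then u * Real.log u - u + 1 else 0) :
    ∫ x, φ (p x / q x) * q x ∂μ ≤ ∫ x, p x * Real.log (p x / q x) ∂μ := by
  have hφ_bounds : ∀ u, 0 ≤ u → 0 ≤ φ u ∧ φ u ≤ u * Real.log u - u + 1 := fun u hu => by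
    have := InformationTheory.klFun_nonneg hu
    rw [InformationTheory.klFun_apply] at this
    rw [hφ_def]
    split_ifs <;> constructor <;> linarith
  have h_sub : Integrable (fun x => p x * Real.log (p x / q x) - p x) μ := hKL_int.sub hp_int
  calc ∫ x, φ (p x / q x) * q x ∂μ
      ≤ ∫ x, (p x * Real.log (p x / q x) - p x + q x) ∂μ := by
        refine integral_mono_of_nonneg (.of_forall fun x => ?_)
          (h_sub.add hq_int) ?_
        · exact mul_nonneg (hφ_bounds _ (div_nonneg (hp_nonneg x) (hq_nonneg x))).1 (hq_nonneg x)
        · filter_upwards [hq_pos] with x hx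
          calc φ (p x / q x) * q x
              ≤ (p x / q x * Real.log (p x / q x) - p x / q x + 1) * q x := by
                gcongr
                exact (hφ_bounds _ (div_nonneg (hp_nonneg x) hx.le)).2
            _ = p x * Real.log (p x / q x) - p x + q x := by
                field_simp
    _ = ∫ x, p x * Real.log (p x / q x) ∂μ := by
        rw [integral_add h_sub hq_int, integral_sub hKL_int hp_int, hp_prob,
          hq_prob, sub_add_cancel]
end

section
/- Let P̄ = (1/(N+1)) ∑_{j=0}^{N} P_j be the average of the probabilities P_0, …, P_N and K̃ = (1/(N+1)) ∑_{j=0}^{N} K(P_j, P̄) the average Kullback–Leibler divergence to P̄. Then (1/(N+1)) ∫_E max_{0≤j≤N} p_j dμ ≤ (K̃ + N/(N+1)) / log(N+1) ≤ (K̃ + 1) / log(N+1). In particular, for every measurable estimator T : E → {0,…,N}, (1/(N+1)) ∑_{j=0}^{N} P_j(T = j) ≤ (K̃ + 1)/log(N+1). -/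
open MeasureTheory

/-- Tangent-line bound for the entropy integrand: `t - s ≤ t * log (t / s)`. -/
theorem sub_le_mul_log_div {t s : ℝ} (ht : 0 ≤ t) (hs : 0 < s) :
    t - s ≤ t * Real.log (t / s) := by
  rcases ht.eq_or_lt with rfl | ht
  · simpa using hs.le
  · have h := mul_le_mul_of_nonneg_left (Real.log_le_sub_one_of_pos (div_pos hs ht)) ht.le
    rw [mul_sub, mul_div_cancel₀ _ ht.ne', ← inv_div t s, Real.log_inv] at h
    linarith

/-- Pointwise form of the Fano-type bound. -/
theorem mul_log_le_sum_mul_log_div_add {N : ℕ} (a : Fin (N + 1) → ℝ) (ha : ∀ j, 0 ≤ a j)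
    (k : Fin (N + 1)) :
    a k * Real.log ((N : ℝ) + 1) ≤
      ∑ j, a j * Real.log (a j / (((N : ℝ) + 1)⁻¹ * ∑ i, a i)) +
        N * (((N : ℝ) + 1)⁻¹ * ∑ i, a i) := by
  have hn : (0 : ℝ) < (N : ℝ) + 1 := by positivity
  set m : ℝ := ((N : ℝ) + 1)⁻¹ * ∑ i, a i with hm
  have hsum : ∑ i, a i = ((N : ℝ) + 1) * m := by rw [hm]; field_simp
  have hle : ∀ j, a j ≤ ∑ i, a i := fun j =>
    Finset.single_le_sum (fun i _ => ha i) (Finset.mem_univ j)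
  have hm0 : 0 ≤ m := mul_nonneg (inv_nonneg.2 hn.le) (Finset.sum_nonneg fun i _ => ha i)
  rcases hm0.eq_or_lt with h0 | hpos
  · have hz : ∀ j, a j = 0 := fun j =>
      le_antisymm ((hle j).trans (by rw [hsum, ← h0, mul_zero])) (ha j)
    simp [hz, ← h0]
  · rw [Fin.sum_univ_succAbove _ k]
    have hothers : ∑ j, (a (k.succAbove j) - m) ≤
        ∑ j, a (k.succAbove j) * Real.log (a (k.succAbove j) / m) :=
      Finset.sum_le_sum fun j _ => sub_le_mul_log_div (ha _) hpos
    have hk : a k * Real.log (a k / (((N : ℝ) + 1) * m)) =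
        a k * Real.log (a k / m) - a k * Real.log ((N : ℝ) + 1) := by
      rcases (ha k).eq_or_lt with h | h
      · simp [← h]
      · rw [← mul_sub, ← Real.log_div (div_pos h hpos).ne' hn.ne', div_div, mul_comm m]
    have hkb := sub_le_mul_log_div (ha k) (mul_pos hn hpos)
    rw [Fin.sum_univ_succAbove _ k] at hsum
    simp only [Finset.sum_sub_distrib, Finset.sum_const, Finset.card_univ, Fintype.card_fin,
      nsmul_eq_mul] at hothers
    linarith

/-- The pointwise maximum of finitely many nonnegative integrable functions is integrable. -/
theorem integrable_iSup_of_nonneg {E ι : Type*} [MeasurableSpace E] {μ : Measure E}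
    [Fintype ι] {p : ι → E → ℝ} (hp_meas : ∀ j, Measurable (p j))
    (hp_nonneg : ∀ j x, 0 ≤ p j x) (hp_int : ∀ j, Integrable (p j) μ) :
    Integrable (fun x => ⨆ j, p j x) μ := by
  refine (integrable_finsetSum Finset.univ fun j _ => hp_int j).mono'
    (Measurable.iSup hp_meas).aestronglyMeasurable (.of_forall fun x => ?_)
  rw [Real.norm_of_nonneg (Real.iSup_nonneg fun j => hp_nonneg j x)]
  exact Real.iSup_le (fun j => Finset.single_le_sum (fun i _ => hp_nonneg i x)
    (Finset.mem_univ j)) (Finset.sum_nonneg fun i _ => hp_nonneg i x)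

/-- Integrating over the cells of a finite measurable partition is dominated by integrating the
maximum. -/
theorem sum_setIntegral_le_integral_iSup {E ι : Type*} [MeasurableSpace E] {μ : Measure E}
    [Fintype ι] [MeasurableSpace ι] [MeasurableSingletonClass ι] {p : ι → E → ℝ}
    (hp_int : ∀ j, Integrable (p j) μ) (hsup : Integrable (fun x => ⨆ j, p j x) μ)
    {T : E → ι} (hT : Measurable T) :
    ∑ j, ∫ x in {x | T x = j}, p j x ∂μ ≤ ∫ x, ⨆ j, p j x ∂μ := by
  have hmeas : ∀ j, MeasurableSet {x | T x = j} := fun j => hT (measurableSet_singleton j)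
  have hunion : ⋃ j, {x | T x = j} = Set.univ := by ext x; simp
  have hdisj : Pairwise (Function.onFun Disjoint fun j => {x | T x = j}) := fun i j hij =>
    Set.disjoint_left.2 fun x hi hj => hij (hi.symm.trans hj)
  rw [← setIntegral_univ, ← hunion,
    integral_iUnion_fintype hmeas hdisj fun j => hsup.integrableOn]
  exact Finset.sum_le_sum fun j _ => setIntegral_mono (hp_int j).integrableOn hsup.integrableOn
    fun x => le_ciSup (f := fun j => p j x) (Set.finite_range _).bddAbove j

/-- Fano-type bound: with `P̄ = (1/(N+1)) ∑_j P_j` (density `p̄ = (1/(N+1)) ∑_j p_j`) and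
`K̃ = (1/(N+1)) ∑_j K(P_j, P̄)`, one has
`(1/(N+1)) ∫ max_j p_j dμ ≤ (K̃ + N/(N+1))/log(N+1) ≤ (K̃ + 1)/log(N+1)`; in particular
for every measurable estimator `T`, `(1/(N+1)) ∑_j P_j(T = j) ≤ (K̃ + 1)/log(N+1)`. -/
theorem fano_type_bound
    {E : Type*} [MeasurableSpace E] (μ : Measure E) (N : ℕ) (hN : 1 ≤ N)
    (p : Fin (N + 1) → E → ℝ)
    (hp_meas : ∀ j, Measurable (p j))
    (hp_nonneg : ∀ j x, 0 ≤ p j x)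
    (hp_int : ∀ j, Integrable (p j) μ)
    (hp_prob : ∀ j, ∫ x, p j x ∂μ = 1)
    (hKL_int : ∀ j, Integrable
      (fun x => p j x * Real.log (p j x / (((N : ℝ) + 1)⁻¹ * ∑ i, p i x))) μ)
    (Ktil : ℝ)
    (hKtil : Ktil = ((N : ℝ) + 1)⁻¹ *
      ∑ j, ∫ x, p j x * Real.log (p j x / (((N : ℝ) + 1)⁻¹ * ∑ i, p i x)) ∂μ) :
    (((N : ℝ) + 1)⁻¹ * ∫ x, ⨆ j, p j x ∂μ ≤
        (Ktil + (N : ℝ) / ((N : ℝ) + 1)) / Real.log ((N : ℝ) + 1)) ∧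
      ((Ktil + (N : ℝ) / ((N : ℝ) + 1)) / Real.log ((N : ℝ) + 1) ≤
        (Ktil + 1) / Real.log ((N : ℝ) + 1)) ∧
      (∀ T : E → Fin (N + 1), Measurable T →
        ((N : ℝ) + 1)⁻¹ * ∑ j, ∫ x in {x | T x = j}, p j x ∂μ ≤
          (Ktil + 1) / Real.log ((N : ℝ) + 1)) := by
  have hn : (0 : ℝ) < (N : ℝ) + 1 := by positivity
  have hlog : 0 < Real.log ((N : ℝ) + 1) :=
    Real.log_pos (by have : (1 : ℝ) ≤ N := by exact_mod_cast hN
                     linarith)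
  have hsup := integrable_iSup_of_nonneg hp_meas hp_nonneg hp_int
  have hsumKL := integrable_finsetSum Finset.univ fun j _ => hKL_int j
  have hmean : Integrable (fun x => (N : ℝ) * (((N : ℝ) + 1)⁻¹ * ∑ i, p i x)) μ :=
    ((integrable_finsetSum Finset.univ fun j _ => hp_int j).const_mul _).const_mul _
  have hkey : (∫ x, ⨆ j, p j x ∂μ) * Real.log ((N : ℝ) + 1) ≤
      ∑ j, ∫ x, p j x * Real.log (p j x / (((N : ℝ) + 1)⁻¹ * ∑ i, p i x)) ∂μ + N := by
    have hmono := integral_mono (hsup.mul_const (Real.log ((N : ℝ) + 1))) (hsumKL.add hmean)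
      fun x => by
        obtain ⟨k, hk⟩ := exists_eq_ciSup_of_finite (f := fun j => p j x)
        change (⨆ j, p j x) * _ ≤ _
        rw [← hk]
        exact mul_log_le_sum_mul_log_div_add (fun j => p j x)
          (fun j => hp_nonneg j x) k
    rw [integral_mul_const, integral_add' hsumKL hmean,
      integral_finsetSum _ fun j _ => hKL_int j, integral_const_mul, integral_const_mul,
      integral_finsetSum _ fun j _ => hp_int j] at hmono
    simpa [hp_prob, hn.ne'] using hmono
  have hmax : ((N : ℝ) + 1)⁻¹ * ∫ x, ⨆ j, p j x ∂μ ≤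
      (Ktil + (N : ℝ) / ((N : ℝ) + 1)) / Real.log ((N : ℝ) + 1) := by
    rw [le_div_iff₀ hlog, hKtil, div_eq_inv_mul, ← mul_add, mul_assoc]
    gcongr
  have hstep : (Ktil + (N : ℝ) / ((N : ℝ) + 1)) / Real.log ((N : ℝ) + 1) ≤
      (Ktil + 1) / Real.log ((N : ℝ) + 1) := by
    gcongr
    rw [div_le_one hn]
    linarith
  refine ⟨hmax, hstep, fun T hT => le_trans ?_ (hmax.trans hstep)⟩
  gcongr
  exact sum_setIntegral_le_integral_iSup hp_int hsup hT
end

section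
/- For every λ ≥ 0 and every probability measure Q = q · μ whose density q is μ-a.e. strictly positive, (∫_E max_{0≤j≤N} p_j(x) dμ(x))^{1+λ} ≤ ∑_{j=0}^{N} ∫_E p_j(x)^{1+λ} q(x)^{−λ} dμ(x). -/
open MeasureTheory

/-- The perspective of `t ↦ t ^ (1 + lam)` lies above its tangent at slope `a`. -/
theorem tangent_le_rpow_mul_rpow_neg {a m q lam : ℝ} (ha : 0 < a) (hm : 0 ≤ m) (hq : 0 < q)
    (hlam : 0 ≤ lam) :
    a ^ (1 + lam) * q + (1 + lam) * a ^ lam * (m - a * q) ≤ m ^ (1 + lam) * q ^ (-lam) := by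
  have hs : 0 ≤ m / (a * q) := by positivity
  have hB := one_add_mul_self_le_rpow_one_add (s := m / (a * q) - 1) (p := 1 + lam)
    (by linarith) (by linarith)
  rw [add_sub_cancel, Real.div_rpow hm (by positivity), Real.mul_rpow ha.le hq.le] at hB
  have hK : 0 ≤ a ^ (1 + lam) * q := by positivity
  have hal : 0 < a ^ lam := by positivity
  have hql : 0 < q ^ lam := by positivity
  calc
    _ = a ^ (1 + lam) * q * (1 + (1 + lam) * (m / (a * q) - 1)) := by
      rw [Real.rpow_add ha, Real.rpow_one]
      field_simp
    _ ≤ a ^ (1 + lam) * q * (m ^ (1 + lam) / (a ^ (1 + lam) * q ^ (1 + lam))) := by gcongr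
    _ = m ^ (1 + lam) * q ^ (-lam) := by
      rw [Real.rpow_add ha, Real.rpow_add hq, Real.rpow_neg hq.le, Real.rpow_one, Real.rpow_one]
      field_simp

/-- A finite supremum of integrable nonnegative real functions is integrable. -/
theorem integrable_ciSup_of_nonneg {E ι : Type*} [MeasurableSpace E] {μ : Measure E}
    [Fintype ι] {f : ι → E → ℝ} (hf_meas : ∀ j, Measurable (f j))
    (hf_nonneg : ∀ j x, 0 ≤ f j x) (hf_int : ∀ j, Integrable (f j) μ) :
    Integrable (fun x => ⨆ j, f j x) μ := by
  refine (integrable_finsetSum Finset.univ fun j _ => hf_int j).mono'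
    (Measurable.iSup hf_meas).aestronglyMeasurable (.of_forall fun x => ?_)
  rw [Real.norm_of_nonneg (Real.iSup_nonneg fun j => hf_nonneg j x)]
  exact Real.iSup_le (fun j => Finset.single_le_sum (fun i _ => hf_nonneg i x) (Finset.mem_univ j))
    (Finset.sum_nonneg fun i _ => hf_nonneg i x)

/-- For every `λ ≥ 0` and every probability measure `Q = q·μ` whose density `q` is
`μ`-a.e. strictly positive,
`(∫ max_j p_j dμ)^{1+λ} ≤ ∑_j ∫ p_j^{1+λ} q^{−λ} dμ`. -/
theorem integral_max_rpow_le
    {E : Type*} [MeasurableSpace E] (μ : Measure E) (N : ℕ) (hN : 1 ≤ N)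
    (p : Fin (N + 1) → E → ℝ)
    (hp_meas : ∀ j, Measurable (p j))
    (hp_nonneg : ∀ j x, 0 ≤ p j x)
    (hp_int : ∀ j, Integrable (p j) μ)
    (hp_prob : ∀ j, ∫ x, p j x ∂μ = 1)
    (q : E → ℝ)
    (hq_meas : Measurable q)
    (hq_nonneg : ∀ x, 0 ≤ q x)
    (hq_int : Integrable q μ)
    (hq_prob : ∫ x, q x ∂μ = 1)
    (hq_pos : ∀ᵐ x ∂μ, 0 < q x)
    (lam : ℝ) (hlam : 0 ≤ lam)
    (h_int : ∀ j, Integrable (fun x => p j x ^ (1 + lam) * q x ^ (-lam)) μ) :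
    (∫ x, ⨆ j, p j x ∂μ) ^ (1 + lam) ≤
      ∑ j, ∫ x, p j x ^ (1 + lam) * q x ^ (-lam) ∂μ := by
  have hM_int := integrable_ciSup_of_nonneg hp_meas hp_nonneg hp_int
  set a := ∫ x, ⨆ j, p j x ∂μ with ha_def
  have ha : 0 < a := by
    have h : ∫ x, p 0 x ∂μ ≤ a :=
      integral_mono (hp_int 0) hM_int fun x => le_ciSup (Finite.bddAbove_range fun j => p j x) 0
    linarith [hp_prob 0]
  have hle : ∀ᵐ x ∂μ,
      a ^ (1 + lam) * q x + (1 + lam) * a ^ lam * ((⨆ j, p j x) - a * q x) ≤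
        ∑ j, p j x ^ (1 + lam) * q x ^ (-lam) := by
    filter_upwards [hq_pos] with x hx
    obtain ⟨i, hi⟩ := exists_eq_ciSup_of_finite (f := fun j => p j x)
    rw [← hi]
    refine (tangent_le_rpow_mul_rpow_neg ha (hp_nonneg i x) hx hlam).trans ?_
    exact Finset.single_le_sum (f := fun j => p j x ^ (1 + lam) * q x ^ (-lam))
      (fun j _ => mul_nonneg (Real.rpow_nonneg (hp_nonneg j x) _) (Real.rpow_nonneg hx.le _))
      (Finset.mem_univ i)
  have hqa := hq_int.const_mul a
  have hq_pow := hq_int.const_mul (a ^ (1 + lam))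
  have hlin := (hM_int.sub hqa).const_mul ((1 + lam) * a ^ lam)
  have hmono := integral_mono_ae (hq_pow.add hlin)
    (integrable_finsetSum Finset.univ fun j _ => h_int j) hle
  rw [integral_finsetSum _ fun j _ => h_int j] at hmono
  refine le_of_eq_of_le ?_ hmono
  rw [integral_add' hq_pow hlin, integral_const_mul, integral_const_mul, integral_sub' hM_int hqa,
    integral_const_mul, hq_prob, ← ha_def]
  ring
end

section
/- For every λ > 0, every probability measure Q = q · μ whose density q is μ-a.e. strictly positive, and every measurable estimator T : E → {0,…,N}, the minimal success probability satisfies min_{0≤j≤N} P_j(T(X) = j) ≤ (1/(N+1)) (∑_{j=0}^{N} ∫_E p_j^{1+λ} q^{−λ} dμ)^{1/(1+λ)}. This improves the inequality of Venkataramanan and Johnson, in which the right-hand side carries the extra factor C(λ) = (1+λ) λ^{−λ/(1+λ)} ≥ 1. -/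
open MeasureTheory

/-- Hölder's inequality against a reference probability density: if `q > 0` a.e. integrates to
`1`, then `∫ f ≤ (∫ f^{1+λ} q^{-λ})^{1/(1+λ)}`. -/
theorem integral_le_integral_rpow_mul_density_rpow {E : Type*} [MeasurableSpace E]
    {μ : Measure E} {f q : E → ℝ} {lam : ℝ} (hlam : 0 < lam)
    (hf_meas : Measurable f) (hf_nonneg : ∀ x, 0 ≤ f x)
    (hq_meas : Measurable q) (hq_nonneg : ∀ x, 0 ≤ q x) (hq_int : Integrable q μ)
    (hq_prob : ∫ x, q x ∂μ = 1) (hq_pos : ∀ᵐ x ∂μ, 0 < q x)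
    (h_int : Integrable (fun x => f x ^ (1 + lam) * q x ^ (-lam)) μ) :
    ∫ x, f x ∂μ ≤ (∫ x, f x ^ (1 + lam) * q x ^ (-lam) ∂μ) ^ (1 / (1 + lam)) := by
  have h1 : 0 < 1 + lam := by linarith
  have hne : 1 + lam ≠ 0 := h1.ne'
  have hconj : (1 + lam).HolderConjugate ((1 + lam) / lam) := by
    rw [Real.holderConjugate_iff]
    refine ⟨by linarith, ?_⟩
    field_simp
  set g : E → ℝ := fun x => f x * q x ^ (-(lam / (1 + lam))) with hg
  set h : E → ℝ := fun x => q x ^ (lam / (1 + lam)) with hh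
  have hg_nonneg : ∀ x, 0 ≤ g x := fun x =>
    mul_nonneg (hf_nonneg x) (Real.rpow_nonneg (hq_nonneg x) _)
  have hh_nonneg : ∀ x, 0 ≤ h x := fun x => Real.rpow_nonneg (hq_nonneg x) _
  have hg_pow : ∀ x, g x ^ (1 + lam) = f x ^ (1 + lam) * q x ^ (-lam) := by
    intro x
    rw [hg]
    dsimp only
    rw [Real.mul_rpow (hf_nonneg x) (Real.rpow_nonneg (hq_nonneg x) _),
      ← Real.rpow_mul (hq_nonneg x)]
    congr 2
    field_simp
  have hh_pow : ∀ x, h x ^ ((1 + lam) / lam) = q x := by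
    intro x
    rw [hh]
    dsimp only
    rw [← Real.rpow_mul (hq_nonneg x), div_mul_div_cancel₀ hne, div_self hlam.ne', Real.rpow_one]
  have hg_meas : Measurable g := hf_meas.mul (hq_meas.pow_const _)
  have hh_meas : Measurable h := hq_meas.pow_const _
  have hg_mem : MemLp g (ENNReal.ofReal (1 + lam)) μ := by
    rw [← integrable_norm_rpow_iff hg_meas.aestronglyMeasurable
      (by simpa using h1) ENNReal.ofReal_ne_top, ENNReal.toReal_ofReal h1.le]
    simpa only [Real.norm_of_nonneg (hg_nonneg _), hg_pow] using h_int
  have hh_mem : MemLp h (ENNReal.ofReal ((1 + lam) / lam)) μ := by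
    rw [← integrable_norm_rpow_iff hh_meas.aestronglyMeasurable
      (by simpa using div_pos h1 hlam) ENNReal.ofReal_ne_top,
      ENNReal.toReal_ofReal (div_pos h1 hlam).le]
    simpa only [Real.norm_of_nonneg (hh_nonneg _), hh_pow] using hq_int
  have key := integral_mul_le_Lp_mul_Lq_of_nonneg hconj (ae_of_all μ hg_nonneg)
    (ae_of_all μ hh_nonneg) hg_mem hh_mem
  simp only [hg_pow, hh_pow, hq_prob, Real.one_rpow, mul_one] at key
  refine le_of_eq_of_le (integral_congr_ae ?_) key
  filter_upwards [hq_pos] with x hx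
  simp only [hg, hh]
  rw [mul_assoc, ← Real.rpow_add hx, neg_add_cancel, Real.rpow_zero, mul_one]

/-- Summing `∫_{T = j} p_j` over `j` integrates the selected function `x ↦ p_{T x}(x)`. -/
theorem sum_setIntegral_fiber_eq_integral {E ι : Type*} [MeasurableSpace E] [Fintype ι]
    [MeasurableSpace ι] [MeasurableSingletonClass ι] {μ : Measure E} {p : ι → E → ℝ}
    (hp_int : ∀ j, Integrable (p j) μ) {T : E → ι} (hT : Measurable T) :
    ∑ j, ∫ x in {x | T x = j}, p j x ∂μ = ∫ x, p (T x) x ∂μ := by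
  classical
  have hs : ∀ j, MeasurableSet {x | T x = j} := fun j => hT (measurableSet_singleton j)
  simp_rw [← integral_indicator (hs _)]
  rw [← integral_finsetSum _ fun j _ => (hp_int j).indicator (hs j)]
  refine integral_congr_ae (ae_of_all μ fun x => ?_)
  simp [Set.indicator_apply]

/-- For every `λ > 0`, every probability measure `Q = q·μ` whose density `q` is `μ`-a.e.
strictly positive, and every measurable estimator `T : E → {0,…,N}`, the minimal success
probability satisfies
`min_j P_j(T = j) ≤ (1/(N+1)) (∑_j ∫ p_j^{1+λ} q^{−λ} dμ)^{1/(1+λ)}`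
(the inequality of Venkataramanan and Johnson with the constant `C(λ)` improved to `1`). -/
theorem min_success_le_vj_bound
    {E : Type*} [MeasurableSpace E] (μ : Measure E) (N : ℕ) (hN : 1 ≤ N)
    (p : Fin (N + 1) → E → ℝ)
    (hp_meas : ∀ j, Measurable (p j))
    (hp_nonneg : ∀ j x, 0 ≤ p j x)
    (hp_int : ∀ j, Integrable (p j) μ)
    (hp_prob : ∀ j, ∫ x, p j x ∂μ = 1)
    (q : E → ℝ)
    (hq_meas : Measurable q)
    (hq_nonneg : ∀ x, 0 ≤ q x)
    (hq_int : Integrable q μ)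
    (hq_prob : ∫ x, q x ∂μ = 1)
    (hq_pos : ∀ᵐ x ∂μ, 0 < q x)
    (lam : ℝ) (hlam : 0 < lam)
    (h_int : ∀ j, Integrable (fun x => p j x ^ (1 + lam) * q x ^ (-lam)) μ)
    (T : E → Fin (N + 1)) (hT : Measurable T) :
    (⨅ j, ∫ x in {x | T x = j}, p j x ∂μ) ≤
      ((N : ℝ) + 1)⁻¹ *
        (∑ j, ∫ x, p j x ^ (1 + lam) * q x ^ (-lam) ∂μ) ^ (1 / (1 + lam)) := by
  have hterm : ∀ j x, 0 ≤ p j x ^ (1 + lam) * q x ^ (-lam) := fun j x =>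
    mul_nonneg (Real.rpow_nonneg (hp_nonneg j x) _) (Real.rpow_nonneg (hq_nonneg x) _)
  have hf_meas : Measurable fun x => p (T x) x :=
    (measurable_from_prod_countable_right (f := fun y : Fin (N + 1) × E => p y.1 y.2)
      hp_meas).comp (hT.prodMk measurable_id)
  have hle : ∀ x, p (T x) x ^ (1 + lam) * q x ^ (-lam) ≤
      ∑ j, p j x ^ (1 + lam) * q x ^ (-lam) := fun x =>
    Finset.single_le_sum (f := fun j => p j x ^ (1 + lam) * q x ^ (-lam))
      (fun j _ => hterm j x) (Finset.mem_univ (T x))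
  have hsum_int := integrable_finsetSum Finset.univ fun j _ => h_int j
  have hf_int : Integrable (fun x => p (T x) x ^ (1 + lam) * q x ^ (-lam)) μ := by
    refine hsum_int.mono'
      ((hf_meas.pow_const _).mul (hq_meas.pow_const _)).aestronglyMeasurable
      (ae_of_all μ fun x => ?_)
    rw [Real.norm_of_nonneg (hterm (T x) x)]
    exact hle x
  have hmin : ((N : ℝ) + 1) * (⨅ j, ∫ x in {x | T x = j}, p j x ∂μ) ≤
      ∑ j, ∫ x in {x | T x = j}, p j x ∂μ := by
    have := Finset.card_nsmul_le_sum Finset.univ (fun j => ∫ x in {x | T x = j}, p j x ∂μ) _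
      fun j _ => ciInf_le (Set.finite_range _).bddBelow j
    simpa using this
  rw [le_inv_mul_iff₀ (by positivity)]
  calc
    _ ≤ ∑ j, ∫ x in {x | T x = j}, p j x ∂μ := hmin
    _ = ∫ x, p (T x) x ∂μ := sum_setIntegral_fiber_eq_integral hp_int hT
    _ ≤ (∫ x, p (T x) x ^ (1 + lam) * q x ^ (-lam) ∂μ) ^ (1 / (1 + lam)) :=
      integral_le_integral_rpow_mul_density_rpow hlam hf_meas (fun x => hp_nonneg (T x) x)
        hq_meas hq_nonneg hq_int hq_prob hq_pos hf_int
    _ ≤ _ := by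
      rw [← integral_finsetSum _ fun j _ => h_int j]
      exact Real.rpow_le_rpow (integral_nonneg fun x => hterm (T x) x)
        (integral_mono hf_int hsum_int hle) (by positivity)
end
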